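/- arXiv:2501.10090 — 2 statements merged into one kernel-verified Lean document; each statement's English description precedes it below -/
import Mathlib

section
/- Let p, q : ℕ → ℝ both satisfy the recurrence u(n) = 3(2n-1)·u(n-1) - (n-1)²·u(n-2) for all n ≥ 2, with initial values p(0) = 0, p(1) = 2, q(0) = 1, q(1) = 3. Then q(n) ≠ 0 for all n, the sequence p(n)/q(n) converges to log 2, and moreover log 2 - p(n)/q(n) is asymptotically equivalent (as n → ∞) to 2π/(1+√2)^{4n+2}. -/
open Filter Real Asymptotics

/-- The normalized central binomial coefficient `binom(2n, n) / 4^n`, that is, the `n`-th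
coefficient of `(1 - x)^(-1/2)`. -/
noncomputable def invSqrtCoeff : ℕ → ℝ
  | 0 => 1
  | n + 1 => invSqrtCoeff n * ((2 * n + 1) / (2 * n + 2))

lemma invSqrtCoeff_pos (n : ℕ) : 0 < invSqrtCoeff n := by
  induction n with
  | zero => simp [invSqrtCoeff]
  | succ n ih => rw [invSqrtCoeff]; positivity

lemma invSqrtCoeff_sq_mul_le (n : ℕ) : invSqrtCoeff n ^ 2 * (n + 1) ≤ 1 := by
  induction n with
  | zero => simp [invSqrtCoeff]
  | succ n ih =>
    refine le_trans ?_ ih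
    rw [invSqrtCoeff, mul_pow, mul_assoc]
    refine mul_le_mul_of_nonneg_left ?_ (sq_nonneg _)
    push_cast
    rw [div_pow, div_mul_eq_mul_div, div_le_iff₀ (by positivity)]
    have : (0 : ℝ) ≤ n := n.cast_nonneg
    nlinarith

lemma invSqrtCoeff_mul_sqrt_le (n : ℕ) : invSqrtCoeff n * √(n + 1) ≤ 1 := by
  have h : (0 : ℝ) ≤ n + 1 := by positivity
  refine (sq_le_sq₀ (by have := invSqrtCoeff_pos n; positivity) zero_le_one).1 ?_
  rw [mul_pow, sq_sqrt h, one_pow]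
  exact invSqrtCoeff_sq_mul_le n

lemma invSqrtCoeff_sq_mul_wallis (n : ℕ) :
    invSqrtCoeff n ^ 2 * (2 * n + 1) * Wallis.W n = 1 := by
  induction n with
  | zero => simp [invSqrtCoeff, Wallis.W]
  | succ n ih =>
    refine Eq.trans ?_ ih
    rw [invSqrtCoeff, Wallis.W_succ]
    push_cast
    field_simp
    ring

lemma tendsto_invSqrtCoeff_mul_sqrt :
    Tendsto (fun n : ℕ => invSqrtCoeff n * √(n + 1)) atTop (nhds (√π)⁻¹) := by
  have h1 : Tendsto (fun n : ℕ => ((n : ℝ) + 1) / (2 * n + 1)) atTop (nhds (1 / 2)) := by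
    have h := (tendsto_one_div_add_atTop_nhds_zero_nat (𝕜 := ℝ))
    have h2 : Tendsto (fun n : ℕ => 1 / (2 - 1 / ((n : ℝ) + 1))) atTop (nhds (1 / (2 - 0))) :=
      tendsto_const_nhds.div (tendsto_const_nhds.sub h) (by norm_num)
    rw [sub_zero] at h2
    refine h2.congr fun n => ?_
    have : (2 - 1 / ((n : ℝ) + 1)) = (2 * n + 1) / (n + 1) := by field_simp; ring
    rw [this, one_div_div]
  have h2 := ((h1.div Wallis.tendsto_W_nhds_pi_div_two (by positivity)).sqrt)
  have h3 : √(1 / 2 / (π / 2)) = (√π)⁻¹ := by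
    rw [← sqrt_inv]; congr 1; field_simp
  rw [h3] at h2
  refine h2.congr fun n => ?_
  have hc := invSqrtCoeff_pos n
  have hW := Wallis.W_pos n
  rw [← sqrt_sq hc.le, ← sqrt_mul (sq_nonneg _), Pi.div_apply]
  congr 1
  rw [div_div, div_eq_iff (by positivity)]
  linear_combination -((n : ℝ) + 1) * invSqrtCoeff_sq_mul_wallis n

/-- The formal power series of `(1 - a X)^(-1/2)`. -/
noncomputable def invSqrtSeries (a : ℝ) : PowerSeries ℝ :=
  PowerSeries.mk fun n => invSqrtCoeff n * a ^ n

open PowerSeries in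
lemma invSqrtSeries_ode (a : ℝ) :
    (1 - C a * X) * d⁄dX ℝ (invSqrtSeries a) = C (a / 2) * invSqrtSeries a := by
  ext n
  rw [sub_mul, one_mul, mul_assoc, map_sub, coeff_C_mul, coeff_C_mul]
  cases n with
  | zero => simp [coeff_derivative, invSqrtSeries, invSqrtCoeff]; ring
  | succ n =>
    rw [coeff_succ_X_mul, coeff_derivative, coeff_derivative]
    simp only [invSqrtSeries, coeff_mk]
    rw [invSqrtCoeff.eq_2 (n + 1)]
    push_cast
    field_simp
    ring

open PowerSeries in
lemma coeff_invSqrtSeries_one_sq (n : ℕ) : coeff n (invSqrtSeries 1 ^ 2) = 1 := by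
  have h := invSqrtSeries_ode 1
  have h2 : d⁄dX ℝ (invSqrtSeries 1 ^ 2) = X * d⁄dX ℝ (invSqrtSeries 1 ^ 2) +
      invSqrtSeries 1 ^ 2 := by
    have h3 : (C (1 / 2 : ℝ) + C (1 / 2)) = 1 := by rw [← map_add]; norm_num
    rw [derivative_pow]
    simp only [map_one, one_mul] at h
    push_cast
    linear_combination 2 * invSqrtSeries 1 * h + invSqrtSeries 1 ^ 2 * h3
  induction n with
  | zero => simp [invSqrtSeries, invSqrtCoeff]
  | succ n ih =>
    have h4 := congrArg (coeff n) h2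
    rw [map_add, coeff_derivative, ih] at h4
    cases n with
    | zero => simpa using h4
    | succ m =>
      rw [coeff_succ_X_mul, coeff_derivative, ih] at h4
      push_cast at h4
      have : (m : ℝ) + 1 + 1 ≠ 0 := by positivity
      apply mul_right_cancel₀ this
      linarith

lemma summable_invSqrtCoeff_mul_pow {x : ℝ} (h0 : 0 ≤ x) (h1 : x < 1) :
    Summable fun n => invSqrtCoeff n * x ^ n := by
  refine Summable.of_nonneg_of_le (fun n => ?_) (fun n => ?_) (summable_geometric_of_lt_one h0 h1)
  · have := invSqrtCoeff_pos n; positivity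
  · refine mul_le_of_le_one_left (by positivity) ?_
    have h := invSqrtCoeff_sq_mul_le n
    have hc := invSqrtCoeff_pos n
    have : (0 : ℝ) ≤ n := n.cast_nonneg
    nlinarith [mul_nonneg (sq_nonneg (invSqrtCoeff n)) this]

lemma tsum_invSqrtCoeff_mul_pow_sq {x : ℝ} (h0 : 0 ≤ x) (h1 : x < 1) :
    (∑' n, invSqrtCoeff n * x ^ n) ^ 2 = (1 - x)⁻¹ := by
  have hs := (summable_invSqrtCoeff_mul_pow h0 h1).norm
  rw [sq, tsum_mul_tsum_eq_tsum_sum_antidiagonal_of_summable_norm hs hs,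
    ← tsum_geometric_of_lt_one h0 h1]
  refine tsum_congr fun n => ?_
  have h := coeff_invSqrtSeries_one_sq n
  rw [sq, PowerSeries.coeff_mul] at h
  simp only [invSqrtSeries, PowerSeries.coeff_mk, one_pow, mul_one] at h
  rw [← one_mul (x ^ n), ← h, Finset.sum_mul]
  refine Finset.sum_congr rfl fun k hk => ?_
  rw [← Finset.HasAntidiagonal.mem_antidiagonal.1 hk, pow_add]
  ring

/-- For `a * b = 1` and `a + b = 6`, the value at `3` of the `n`-th Legendre polynomial. -/
noncomputable def legendreCoeff (a b : ℝ) (n : ℕ) : ℝ :=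
  PowerSeries.coeff n (invSqrtSeries a * invSqrtSeries b)

lemma legendreCoeff_eq_sum (a b : ℝ) (n : ℕ) :
    legendreCoeff a b n = ∑ k ∈ Finset.range (n + 1),
      (invSqrtCoeff k * b ^ k) * (invSqrtCoeff (n - k) * a ^ (n - k)) := by
  rw [legendreCoeff, mul_comm, PowerSeries.coeff_mul,
    Finset.Nat.sum_antidiagonal_eq_sum_range_succ_mk]
  simp [invSqrtSeries]

lemma legendreCoeff_pos {a b : ℝ} (ha : 0 < a) (hb : 0 < b) (n : ℕ) :
    0 < legendreCoeff a b n := by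
  rw [legendreCoeff_eq_sum]
  refine Finset.sum_pos (fun k _ => ?_) (by simp)
  have := invSqrtCoeff_pos k
  have := invSqrtCoeff_pos (n - k)
  positivity

open PowerSeries in
lemma legendreCoeff_rec {a b : ℝ} (hab : a * b = 1) (hs : a + b = 6) (n : ℕ) :
    (n + 2) * legendreCoeff a b (n + 2) =
      3 * (2 * n + 3) * legendreCoeff a b (n + 1) - (n + 1) * legendreCoeff a b n := by
  have ha := invSqrtSeries_ode a
  have hb := invSqrtSeries_ode b
  set A := invSqrtSeries a with hA
  set B := invSqrtSeries b with hB
  have hp : C a * C b = (1 : PowerSeries ℝ) := by rw [← map_mul, hab, map_one]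
  have hs' : C a + C b = (C 6 : PowerSeries ℝ) := by rw [← map_add, hs]
  have ha2 : C a = C (a / 2) + C (a / 2) := by rw [← map_add]; congr 1; ring
  have hb2 : C b = C (b / 2) + C (b / 2) := by rw [← map_add]; congr 1; ring
  have h62 : (C 6 : PowerSeries ℝ) = C 3 + C 3 := by rw [← map_add]; norm_num
  have h3 : C (a / 2) + C (b / 2) = (C 3 : PowerSeries ℝ) := by
    rw [← map_add]; congr 1; linarith
  have hp' : C (a / 2) * C b + C (b / 2) * C a = (1 : PowerSeries ℝ) := by
    rw [← map_mul, ← map_mul, ← map_add, ← map_one C]; congr 1; linarith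
  have hode : d⁄dX ℝ (A * B) - C 6 * (X * d⁄dX ℝ (A * B)) + X * (X * d⁄dX ℝ (A * B)) =
      C 3 * (A * B) - X * (A * B) := by
    rw [Derivation.leibniz, smul_eq_mul, smul_eq_mul]
    linear_combination (1 - C b * X) * B * ha + (1 - C a * X) * A * hb
      - X ^ 2 * (A * d⁄dX ℝ B + B * d⁄dX ℝ A) * hp
      + X * (A * d⁄dX ℝ B + B * d⁄dX ℝ A) * hs' + A * B * h3 - X * A * B * hp'
  have h := congrArg (coeff (n + 1)) hode
  simp only [map_sub, map_add, coeff_C_mul, coeff_succ_X_mul, coeff_derivative] at h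
  simp only [legendreCoeff, ← hA, ← hB]
  cases n with
  | zero =>
    simp at h ⊢
    linarith
  | succ n =>
    simp only [coeff_succ_X_mul, coeff_derivative] at h
    push_cast at h ⊢
    linarith

lemma legendreCoeff_zero (a b : ℝ) : legendreCoeff a b 0 = 1 := by
  simp [legendreCoeff_eq_sum, invSqrtCoeff]

lemma legendreCoeff_one {a b : ℝ} (hs : a + b = 6) : legendreCoeff a b 1 = 3 := by
  simp [legendreCoeff_eq_sum, invSqrtCoeff, Finset.sum_range_succ]
  linarith

lemma tendsto_legendreCoeff {a b : ℝ} (hb0 : 0 < b) (hb1 : b < 1) (hab : a * b = 1) :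
    Tendsto (fun n : ℕ => legendreCoeff a b n * √(n + 1) * b ^ n) atTop
      (nhds (∑' k, invSqrtCoeff k * (b ^ 2) ^ k * (√π)⁻¹)) := by
  have hb2 : b ^ 2 < 1 := by nlinarith
  have key := tendsto_tsum_of_dominated_convergence (𝓕 := atTop)
    (f := fun n k : ℕ => if k ≤ n then
      invSqrtCoeff k * (b ^ 2) ^ k * (invSqrtCoeff (n - k) * √(n + 1)) else 0)
    (g := fun k => invSqrtCoeff k * (b ^ 2) ^ k * (√π)⁻¹) (bound := fun k => (b ^ 2) ^ k)
    (summable_geometric_of_lt_one (sq_nonneg b) hb2) ?_ ?_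
  · refine key.congr fun n => ?_
    rw [tsum_eq_sum (s := Finset.range (n + 1)), legendreCoeff_eq_sum, Finset.sum_mul,
      Finset.sum_mul]
    · refine Finset.sum_congr rfl fun k hk => ?_
      have hk' : k ≤ n := by simpa [Nat.lt_succ_iff] using hk
      rw [if_pos hk']
      have h : a ^ (n - k) * b ^ n = b ^ k := by
        conv_lhs => rw [← Nat.sub_add_cancel hk', pow_add, ← mul_assoc, Nat.add_sub_cancel,
          ← mul_pow, hab, one_pow, one_mul]
      rw [← pow_mul, mul_comm 2 k, pow_mul, sq]
      linear_combination -(invSqrtCoeff k * b ^ k * invSqrtCoeff (n - k) * √(n + 1)) * h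
    · intro k hk
      rw [if_neg (by simpa [Nat.lt_succ_iff] using hk)]
  · intro k
    refine Tendsto.const_mul (invSqrtCoeff k * (b ^ 2) ^ k) (f := fun n : ℕ =>
      invSqrtCoeff (n - k) * √(n + 1)) ?_ |>.congr' ?_
    · have h1 := tendsto_invSqrtCoeff_mul_sqrt.comp (tendsto_sub_atTop_nat k)
      have h2 : Tendsto (fun n : ℕ => √(1 + k * (1 / ((n : ℝ) + 1)))) atTop (nhds √(1 + k * 0)) :=
        (tendsto_const_nhds.add (tendsto_const_nhds.mul
          tendsto_one_div_add_atTop_nhds_zero_nat)).sqrt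
      have h3 := h1.mul (h2.comp (tendsto_sub_atTop_nat k))
      rw [mul_zero, add_zero, sqrt_one, mul_one] at h3
      refine h3.congr' ?_
      filter_upwards [eventually_ge_atTop k] with n hn
      simp only [Function.comp_apply]
      rw [mul_assoc, ← sqrt_mul (by positivity)]
      congr 2
      rw [Nat.cast_sub hn]
      have : (n : ℝ) - k + 1 ≠ 0 := by
        have : (k : ℝ) ≤ n := by exact_mod_cast hn
        linarith
      field_simp
      ring
    · filter_upwards [eventually_ge_atTop k] with n hn
      rw [if_pos hn]
  · refine Eventually.of_forall fun n k => ?_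
    split_ifs with hk
    · have hc := invSqrtCoeff_pos k
      have hc' := invSqrtCoeff_pos (n - k)
      rw [norm_of_nonneg (by positivity)]
      have hle : √((n : ℝ) + 1) ≤ √(k + 1) * √(((n - k : ℕ) : ℝ) + 1) := by
        rw [← sqrt_mul (by positivity)]
        refine sqrt_le_sqrt ?_
        rw [Nat.cast_sub hk]
        have : (k : ℝ) ≤ n := by exact_mod_cast hk
        have h0 : (0 : ℝ) ≤ k := k.cast_nonneg
        nlinarith
      have hone : (invSqrtCoeff k * √(k + 1)) *
          (invSqrtCoeff (n - k) * √(((n - k : ℕ) : ℝ) + 1)) ≤ 1 :=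
        mul_le_one₀ (invSqrtCoeff_mul_sqrt_le k) (by positivity) (invSqrtCoeff_mul_sqrt_le _)
      calc invSqrtCoeff k * (b ^ 2) ^ k * (invSqrtCoeff (n - k) * √(n + 1))
          ≤ invSqrtCoeff k * (b ^ 2) ^ k *
            (invSqrtCoeff (n - k) * (√(k + 1) * √(((n - k : ℕ) : ℝ) + 1))) := by gcongr
        _ = (b ^ 2) ^ k * ((invSqrtCoeff k * √(k + 1)) *
          (invSqrtCoeff (n - k) * √(((n - k : ℕ) : ℝ) + 1))) := by ring
        _ ≤ (b ^ 2) ^ k := mul_le_of_le_one_right (by positivity) hone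
    · simp only [norm_zero]; positivity

/-- The integral of `(x(1-x)/(1+x))^n / (1+x)` over `[0, 1]`. -/
noncomputable def legendreIntegral (n : ℕ) : ℝ :=
  ∫ x in (0 : ℝ)..1, (x * (1 - x) / (1 + x)) ^ n / (1 + x)

lemma intervalIntegrable_legendreIntegrand (n : ℕ) :
    IntervalIntegrable (fun x : ℝ => (x * (1 - x) / (1 + x)) ^ n / (1 + x))
      MeasureTheory.volume 0 1 := by
  refine ContinuousOn.intervalIntegrable fun x hx => ContinuousAt.continuousWithinAt ?_
  rw [Set.uIcc_of_le zero_le_one] at hx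
  have : 1 + x ≠ 0 := by linarith [hx.1]
  fun_prop (disch := assumption)

lemma legendreIntegral_zero : legendreIntegral 0 = log 2 := by
  have h := intervalIntegral.integral_comp_add_left (fun x : ℝ => 1 / x) 1 (a := 0) (b := 1)
  simp only [legendreIntegral, pow_zero]
  rw [h, integral_one_div (by norm_num)]
  norm_num

lemma hasDerivAt_legendreIntegrand_primitive (n : ℕ) {x : ℝ} (hx : 0 ≤ x) :
    HasDerivAt (fun x : ℝ => (x * (1 - x) / (1 + x)) ^ n * (2 / (1 + x) - (1 + x)))
      (n * (x * (1 - x) / (1 + x)) ^ (n - 1) * ((1 - 2 * x - x ^ 2) / (1 + x) ^ 2) *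
        (2 / (1 + x) - (1 + x)) +
        (x * (1 - x) / (1 + x)) ^ n * (-2 / (1 + x) ^ 2 - 1)) x := by
  have h1 : 1 + x ≠ 0 := by linarith
  have hd : HasDerivAt (fun x : ℝ => 1 + x) 1 x := (hasDerivAt_id x).const_add 1
  have hu := ((hasDerivAt_id x).mul ((hasDerivAt_id x).const_sub 1)).div hd h1
  have hh := ((hasDerivAt_const x (2 : ℝ)).div hd h1).sub hd
  refine ((hu.pow n).mul hh).congr_deriv ?_
  simp only [Pi.mul_apply, Pi.div_apply, Pi.pow_apply, Pi.sub_apply, id]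
  congr 2
  · congr 1
    field_simp
    ring
  · field_simp
    ring

lemma legendreIntegral_one : legendreIntegral 1 = 3 * legendreIntegral 0 - 2 := by
  have h0 := intervalIntegrable_legendreIntegrand 0
  have h1 := intervalIntegrable_legendreIntegrand 1
  have h := intervalIntegral.integral_eq_sub_of_hasDerivAt (a := 0) (b := 1)
    (f := fun x : ℝ => (x * (1 - x) / (1 + x)) ^ 0 * (2 / (1 + x) - (1 + x)))
    (f' := fun x : ℝ => (x * (1 - x) / (1 + x)) ^ 1 / (1 + x) -
      3 * ((x * (1 - x) / (1 + x)) ^ 0 / (1 + x))) ?_ (h1.sub (h0.const_mul 3))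
  · rw [intervalIntegral.integral_sub h1 (h0.const_mul 3),
      intervalIntegral.integral_const_mul] at h
    norm_num at h
    simp only [legendreIntegral, pow_one, pow_zero]
    norm_num
    linarith
  · intro x hx
    rw [Set.uIcc_of_le zero_le_one] at hx
    have hx1 : 1 + x ≠ 0 := by linarith [hx.1]
    refine (hasDerivAt_legendreIntegrand_primitive 0 hx.1).congr_deriv ?_
    simp only [Nat.cast_zero, zero_mul, zero_add, pow_zero, pow_one, one_mul]
    field_simp
    ring

lemma legendreIntegral_rec (n : ℕ) :
    (n + 2) * legendreIntegral (n + 2) =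
      3 * (2 * n + 3) * legendreIntegral (n + 1) - (n + 1) * legendreIntegral n := by
  have h0 := (intervalIntegrable_legendreIntegrand n).const_mul ((n : ℝ) + 1)
  have h1 := (intervalIntegrable_legendreIntegrand (n + 1)).const_mul (3 * (2 * (n : ℝ) + 3))
  have h2 := (intervalIntegrable_legendreIntegrand (n + 2)).const_mul ((n : ℝ) + 2)
  have h := intervalIntegral.integral_eq_sub_of_hasDerivAt (a := 0) (b := 1)
    (f := fun x : ℝ => (x * (1 - x) / (1 + x)) ^ (n + 1) * (2 / (1 + x) - (1 + x)))
    (f' := fun x : ℝ => ((n : ℝ) + 2) * ((x * (1 - x) / (1 + x)) ^ (n + 2) / (1 + x)) -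
      3 * (2 * (n : ℝ) + 3) * ((x * (1 - x) / (1 + x)) ^ (n + 1) / (1 + x)) +
      ((n : ℝ) + 1) * ((x * (1 - x) / (1 + x)) ^ n / (1 + x))) ?_ ((h2.sub h1).add h0)
  · rw [intervalIntegral.integral_add (h2.sub h1) h0, intervalIntegral.integral_sub h2 h1,
      intervalIntegral.integral_const_mul, intervalIntegral.integral_const_mul,
      intervalIntegral.integral_const_mul] at h
    simp only [zero_mul, sub_self, mul_zero, zero_div, ne_eq, Nat.succ_ne_zero,
      not_false_eq_true, zero_pow] at h
    simp only [legendreIntegral]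
    linarith
  · intro x hx
    rw [Set.uIcc_of_le zero_le_one] at hx
    have hx1 : 1 + x ≠ 0 := by linarith [hx.1]
    refine (hasDerivAt_legendreIntegrand_primitive (n + 1) hx.1).congr_deriv ?_
    rw [Nat.add_sub_cancel, pow_add _ n 2, pow_add _ n 1]
    generalize (x * (1 - x) / (1 + x)) ^ n = v
    push_cast
    field_simp
    ring

lemma legendreIntegral_mem_Icc (n : ℕ) : legendreIntegral n ∈ Set.Icc 0 1 := by
  have hb : ∀ x ∈ Set.Icc (0 : ℝ) 1, 0 ≤ x * (1 - x) / (1 + x) ∧ x * (1 - x) / (1 + x) ≤ 1 := by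
    intro x hx
    have h1 : 0 < 1 + x := by linarith [hx.1]
    refine ⟨div_nonneg (mul_nonneg hx.1 (by linarith [hx.2])) h1.le, ?_⟩
    rw [div_le_one h1]
    nlinarith [hx.1]
  constructor
  · refine intervalIntegral.integral_nonneg zero_le_one fun x hx => ?_
    exact div_nonneg (pow_nonneg (hb x hx).1 n) (by linarith [hx.1])
  · calc legendreIntegral n ≤ ∫ _ in (0 : ℝ)..1, (1 : ℝ) := by
          refine intervalIntegral.integral_mono_on zero_le_one
            (intervalIntegrable_legendreIntegrand n) (by simp) fun x hx => ?_
          have h1 : 0 < 1 + x := by linarith [hx.1]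
          rw [div_le_one h1]
          exact (pow_le_one₀ (hb x hx).1 (hb x hx).2).trans (by linarith [hx.1])
      _ = 1 := by simp

/-- The Stolz-Cesàro theorem for null sequences, with limit one. -/
lemma isEquivalent_of_tendsto_zero_of_sub_succ {u v : ℕ → ℝ} (hu : Tendsto u atTop (nhds 0))
    (hv : Tendsto v atTop (nhds 0)) (hanti : StrictAnti v)
    (h : Tendsto (fun n => (u n - u (n + 1)) / (v n - v (n + 1))) atTop (nhds 1)) :
    u ~[atTop] v := by
  refine IsLittleO.of_bound fun ε hε => ?_
  have hd : ∀ n, 0 < v n - v (n + 1) := fun n => sub_pos.2 (hanti n.lt_succ_self)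
  have hpos : ∀ n, 0 < v n := fun n =>
    (hanti.antitone.le_of_tendsto hv (n + 1)).trans_lt (hanti n.lt_succ_self)
  obtain ⟨N, hN⟩ := eventually_atTop.1 (h.eventually (Metric.closedBall_mem_nhds 1 hε))
  filter_upwards [eventually_ge_atTop N] with n hn
  have hstep : ∀ m ≥ N, |(u m - v m) - (u (m + 1) - v (m + 1))| ≤ ε * (v m - v (m + 1)) := by
    intro m hm
    have h1 := hN m hm
    rw [Real.dist_eq, div_sub_one (hd m).ne', abs_div,
      abs_of_pos (hd m), div_le_iff₀ (hd m)] at h1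
    rwa [sub_sub_sub_comm]
  have key : ∀ s : ℝ, |s| = 1 → s * (u n - v n) ≤ ε * v n := by
    intro s hs
    have hmono : Antitone fun k => ε * v (n + k) - s * (u (n + k) - v (n + k)) := by
      refine antitone_nat_of_succ_le fun k => ?_
      have h1 := hstep (n + k) (by omega)
      have h2 := le_abs_self (s * ((u (n + k) - v (n + k)) - (u (n + k + 1) - v (n + k + 1))))
      rw [abs_mul, hs, one_mul] at h2
      simp only [← add_assoc]
      linarith
    have hlim : Tendsto (fun k => ε * v (n + k) - s * (u (n + k) - v (n + k))) atTop
        (nhds (ε * 0 - s * (0 - 0))) := by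
      have hs : Tendsto (fun k => n + k) atTop atTop :=
        tendsto_atTop_mono (fun k => Nat.le_add_left k n) tendsto_id
      exact ((hv.comp hs).const_mul ε).sub
        (((hu.comp hs).sub (hv.comp hs)).const_mul s)
    have := hmono.le_of_tendsto hlim 0
    simp only [add_zero] at this
    linarith
  have h1 := key 1 (by simp)
  have h2 := key (-1) (by simp)
  rw [Pi.sub_apply, norm_eq_abs, norm_eq_abs, abs_of_pos (hpos n), abs_le]
  constructor <;> linarith

lemma legendreIntegral_mul_legendreCoeff_sub {a b : ℝ} (hab : a * b = 1) (hs : a + b = 6)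
    (n : ℕ) :
    (n + 1) * (legendreIntegral n * legendreCoeff a b (n + 1) -
      legendreIntegral (n + 1) * legendreCoeff a b n) = 2 := by
  induction n with
  | zero =>
    rw [zero_add, legendreCoeff_one hs, legendreCoeff_zero, legendreIntegral_one]
    push_cast
    ring
  | succ n ih =>
    push_cast
    linear_combination ih + legendreIntegral (n + 1) * legendreCoeff_rec hab hs n -
      legendreCoeff a b (n + 1) * legendreIntegral_rec n

/-- Solutions of the recurrence of the continued fraction correspond, after division by `n!`,
to solutions of the Legendre recurrence. -/
lemma eq_factorial_mul_of_rec {u w : ℕ → ℝ}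
    (hu : ∀ n : ℕ, 2 ≤ n →
      u n = 3 * (2 * (n : ℝ) - 1) * u (n - 1) - ((n : ℝ) - 1) ^ 2 * u (n - 2))
    (hw : ∀ n : ℕ, (n + 2) * w (n + 2) = 3 * (2 * n + 3) * w (n + 1) - (n + 1) * w n)
    (h0 : u 0 = w 0) (h1 : u 1 = w 1) (n : ℕ) : u n = n.factorial * w n := by
  induction n using Nat.twoStepInduction with
  | zero => simp [h0]
  | one => simp [h1]
  | more n ih0 ih1 =>
    have h := hu (n + 2) (by omega)
    rw [show n + 2 - 1 = n + 1 by omega, Nat.add_sub_cancel, ih0, ih1] at h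
    rw [h, Nat.factorial_succ (n + 1), Nat.factorial_succ n]
    push_cast
    linear_combination -((n : ℝ) + 1) * n.factorial * hw n

lemma tendsto_legendreIntegral_div_legendreCoeff {a b : ℝ} (hb0 : 0 < b) (hb1 : b < 1)
    (hab : a * b = 1) {c : ℝ} (hc : c ≠ 0)
    (h : Tendsto (fun n : ℕ => legendreCoeff a b n * √(n + 1) * b ^ n) atTop (nhds c)) :
    Tendsto (fun n => legendreIntegral n / legendreCoeff a b n) atTop (nhds 0) := by
  have h1 : Tendsto (fun n : ℕ => (n : ℝ) * b ^ n + b ^ n) atTop (nhds (0 + 0)) :=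
    (tendsto_self_mul_const_pow_of_lt_one hb0.le hb1).add
      (tendsto_pow_atTop_nhds_zero_of_lt_one hb0.le hb1)
  rw [add_zero] at h1
  have h2 : Tendsto (fun n : ℕ => legendreIntegral n * (√(n + 1) * b ^ n)) atTop (nhds 0) := by
    refine squeeze_zero (fun n => ?_) (fun n => ?_) h1
    · have := (legendreIntegral_mem_Icc n).1
      positivity
    · have hs : √((n : ℝ) + 1) ≤ n + 1 := by
        rw [sqrt_le_left (by positivity)]
        nlinarith [(n.cast_nonneg : (0 : ℝ) ≤ n)]
      calc legendreIntegral n * (√(n + 1) * b ^ n) ≤ √(n + 1) * b ^ n :=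
            mul_le_of_le_one_left (by positivity) (legendreIntegral_mem_Icc n).2
        _ ≤ (n + 1) * b ^ n := by gcongr
        _ = n * b ^ n + b ^ n := by ring
  have h3 := h2.div h hc
  rw [zero_div] at h3
  refine h3.congr fun n => ?_
  have hs : √((n : ℝ) + 1) ≠ 0 := by positivity
  have := (legendreCoeff_pos (pos_of_mul_pos_left (hab ▸ one_pos) hb0.le) hb0 n).ne'
  rw [Pi.div_apply]
  field_simp

lemma legendreIntegral_div_legendreCoeff_isEquivalent {a b : ℝ} (hb0 : 0 < b) (hb1 : b < 1)
    (hab : a * b = 1) (hs : a + b = 6) :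
    Tendsto (fun n => legendreIntegral n / legendreCoeff a b n) atTop (nhds 0) ∧
    (fun n => legendreIntegral n / legendreCoeff a b n) ~[atTop]
      (fun n => 2 * π * b ^ (2 * n + 1)) := by
  have hb2 : b ^ 2 < 1 := by nlinarith
  have hpos := legendreCoeff_pos (pos_of_mul_pos_left (hab ▸ one_pos) hb0.le) hb0
  have hlim := tendsto_legendreCoeff hb0 hb1 hab
  rw [tsum_mul_right] at hlim
  set S := ∑' k, invSqrtCoeff k * (b ^ 2) ^ k with hS
  have hS2 : S ^ 2 = (1 - b ^ 2)⁻¹ := tsum_invSqrtCoeff_mul_pow_sq (sq_nonneg b) hb2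
  have hS0 : S ≠ 0 := by
    rintro h0
    rw [h0, zero_pow two_ne_zero] at hS2
    exact (inv_pos.2 (sub_pos.2 hb2)).ne hS2
  have hc : S * (√π)⁻¹ ≠ 0 := mul_ne_zero hS0 (by positivity)
  have hzero := tendsto_legendreIntegral_div_legendreCoeff hb0 hb1 hab hc hlim
  refine ⟨hzero, isEquivalent_of_tendsto_zero_of_sub_succ hzero ?_ ?_ ?_⟩
  · have h1 := ((tendsto_pow_atTop_nhds_zero_of_lt_one (sq_nonneg b) hb2).const_mul (2 * π * b))
    rw [mul_zero] at h1
    refine h1.congr fun n => ?_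
    rw [← pow_mul]
    ring
  · refine strictAnti_nat_of_succ_lt fun n => ?_
    refine mul_lt_mul_of_pos_left ?_ (by positivity)
    exact pow_lt_pow_right_of_lt_one₀ hb0 hb1 (by omega)
  · have hratio : Tendsto (fun n : ℕ => √(1 - 1 / (((n + 1 : ℕ) : ℝ) + 1))) atTop
        (nhds √(1 - 0)) :=
      (tendsto_const_nhds.sub (tendsto_one_div_add_atTop_nhds_zero_nat.comp
        (tendsto_add_atTop_nat 1))).sqrt
    rw [sub_zero, sqrt_one] at hratio
    have hprod := (((hlim.mul (hlim.comp (tendsto_add_atTop_nat 1))).mul hratio).mul_const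
      (π * (1 - b ^ 2))).inv₀ (mul_ne_zero (mul_ne_zero (mul_ne_zero hc hc) one_ne_zero)
        (mul_ne_zero pi_ne_zero (sub_pos.2 hb2).ne'))
    have hone : (S * (√π)⁻¹ * (S * (√π)⁻¹) * 1 * (π * (1 - b ^ 2)))⁻¹ = 1 := by
      have hb2' := (sub_pos.2 hb2).ne'
      have hpi : (√π)⁻¹ ^ 2 = π⁻¹ := by rw [inv_pow, sq_sqrt pi_pos.le]
      rw [show S * (√π)⁻¹ * (S * (√π)⁻¹) * 1 * (π * (1 - b ^ 2)) =
        S ^ 2 * (√π)⁻¹ ^ 2 * (π * (1 - b ^ 2)) by ring, hS2, hpi]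
      field_simp
    rw [hone] at hprod
    refine hprod.congr fun n => ?_
    have hcas := legendreIntegral_mul_legendreCoeff_sub hab hs n
    have hp0 := hpos n
    have hp1 := hpos (n + 1)
    have hb2' := (sub_pos.2 hb2)
    have hsq : √(1 - 1 / (((n + 1 : ℕ) : ℝ) + 1)) * √(((n + 1 : ℕ) : ℝ) + 1) = √((n : ℝ) + 1) := by
      rw [← sqrt_mul' _ (by positivity)]
      congr 1
      push_cast
      field_simp
      ring
    have hsq2 : √((n : ℝ) + 1) * √((n : ℝ) + 1) = n + 1 := mul_self_sqrt (by positivity)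
    have hdiff : legendreIntegral n / legendreCoeff a b n -
        legendreIntegral (n + 1) / legendreCoeff a b (n + 1) =
        2 / ((n + 1) * (legendreCoeff a b n * legendreCoeff a b (n + 1))) := by
      rw [← hcas]
      field_simp
    have hden : legendreCoeff a b n * √(n + 1) * b ^ n *
        (legendreCoeff a b (n + 1) * √(((n + 1 : ℕ) : ℝ) + 1) * b ^ (n + 1)) *
        √(1 - 1 / (((n + 1 : ℕ) : ℝ) + 1)) =
        (n + 1) * (legendreCoeff a b n * legendreCoeff a b (n + 1)) * b ^ (2 * n + 1) := by
      linear_combination legendreCoeff a b n * legendreCoeff a b (n + 1) * b ^ (2 * n + 1) *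
        (√((n : ℝ) + 1) * hsq + hsq2)
    rw [Function.comp_apply, hden, hdiff]
    rw [show 2 * (n + 1) + 1 = (2 * n + 1) + 2 by ring, pow_add b (2 * n + 1) 2,
      show 2 * π * b ^ (2 * n + 1) - 2 * π * (b ^ (2 * n + 1) * b ^ 2) =
        2 * π * b ^ (2 * n + 1) * (1 - b ^ 2) by ring]
    field_simp

/-- Tiny Apéry: the continued fraction `[[0,3(2n-1)],[2,-n^2]]` converges to `log 2`,
with speed `2π/(1+√2)^(4n+2)`. -/
theorem tiny_apery (p q : ℕ → ℝ)
    (hp : ∀ n : ℕ, 2 ≤ n →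
      p n = 3 * (2 * (n : ℝ) - 1) * p (n - 1) - ((n : ℝ) - 1) ^ 2 * p (n - 2))
    (hq : ∀ n : ℕ, 2 ≤ n →
      q n = 3 * (2 * (n : ℝ) - 1) * q (n - 1) - ((n : ℝ) - 1) ^ 2 * q (n - 2))
    (hp0 : p 0 = 0) (hp1 : p 1 = 2) (hq0 : q 0 = 1) (hq1 : q 1 = 3) :
    (∀ n, q n ≠ 0) ∧
    Tendsto (fun n => p n / q n) atTop (nhds (Real.log 2)) ∧
    (fun n : ℕ => Real.log 2 - p n / q n) ~[atTop]
      (fun n : ℕ => 2 * π / (1 + Real.sqrt 2) ^ (4 * n + 2)) := by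
  have h2 : √2 ^ 2 = 2 := sq_sqrt zero_le_two
  have hlt : 1 < √2 := by rw [lt_sqrt] <;> norm_num
  set a : ℝ := (1 + √2) ^ 2 with ha
  set b : ℝ := (√2 - 1) ^ 2 with hb
  have hab : a * b = 1 := by
    rw [ha, hb, ← mul_pow, show (1 + √2) * (√2 - 1) = √2 ^ 2 - 1 by ring, h2]
    norm_num
  have hs : a + b = 6 := by rw [ha, hb]; linarith
  have hb0 : 0 < b := pow_pos (sub_pos.2 hlt) 2
  have hb1 : b < 1 := by rw [hb]; nlinarith
  have ha0 : 0 < a := by rw [ha]; positivity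
  have hpos := legendreCoeff_pos ha0 hb0
  have hqn : ∀ n, q n = n.factorial * legendreCoeff a b n :=
    eq_factorial_mul_of_rec hq (legendreCoeff_rec hab hs)
      (by rw [hq0, legendreCoeff_zero]) (by rw [hq1, legendreCoeff_one hs])
  have hrn : ∀ n, q n * log 2 - p n = n.factorial * legendreIntegral n := by
    refine eq_factorial_mul_of_rec (u := fun n => q n * log 2 - p n) (fun n hn => ?_)
      legendreIntegral_rec ?_ ?_
    · rw [hp n hn, hq n hn]
      ring
    · rw [hp0, hq0, legendreIntegral_zero]
      ring
    · rw [hp1, hq1, legendreIntegral_one, legendreIntegral_zero]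
  have hq_ne : ∀ n, q n ≠ 0 := fun n => by
    rw [hqn]
    exact mul_ne_zero (by positivity) (hpos n).ne'
  have herr : ∀ n, log 2 - p n / q n = legendreIntegral n / legendreCoeff a b n := by
    intro n
    have hfac : (n.factorial : ℝ) ≠ 0 := by positivity
    rw [← mul_div_mul_left (legendreIntegral n) _ hfac, ← hrn, ← hqn, sub_div, mul_div_cancel_left₀ _ (hq_ne n)]
  obtain ⟨hzero, hequiv⟩ := legendreIntegral_div_legendreCoeff_isEquivalent hb0 hb1 hab hs
  refine ⟨hq_ne, ?_, ?_⟩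
  · have := hzero.const_sub (log 2)
    rw [sub_zero] at this
    refine this.congr fun n => ?_
    rw [← herr]
    ring
  · simp only [herr]
    convert hequiv using 2 with n
    rw [show 4 * n + 2 = 2 * (2 * n + 1) by ring, pow_mul, ← ha,
      eq_inv_of_mul_eq_one_right hab, inv_pow, div_eq_mul_inv]
end

section
/- Let p, q : ℕ → ℝ both satisfy the recurrence u(n) = (11n² - 11n + 3)·u(n-1) + (n-1)⁴·u(n-2) for all n ≥ 2, with initial values p(0) = 0, p(1) = 5, q(0) = 1, q(1) = 3. Then q(n) ≠ 0 for all n, the sequence p(n)/q(n) converges to ζ(2) = π²/6, and moreover ζ(2) - p(n)/q(n) is asymptotically equivalent (as n → ∞) to (-1)ⁿ·4π²/((1+√5)/2)^{10n+5}. -/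
open Filter Real Asymptotics

/-- The summand `C(n,k)² C(n+k,k)` of the Apéry numbers for `ζ(2)`. -/
def aperyTerm (n k : ℕ) : ℝ := (n.choose k : ℝ) ^ 2 * ((n + k).choose k : ℝ)

/-- The Apéry numbers `∑ C(n,k)² C(n+k,k)` for `ζ(2)`. -/
def aperyNumber (n : ℕ) : ℝ := ∑ k ∈ Finset.range (n + 1), aperyTerm n k

lemma aperyTerm_eq_zero {n k : ℕ} (h : n < k) : aperyTerm n k = 0 := by
  simp [aperyTerm, Nat.choose_eq_zero_of_lt h]

lemma aperyTerm_zero_right (n : ℕ) : aperyTerm n 0 = 1 := by simp [aperyTerm]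

lemma aperyTerm_add_left (k j : ℕ) :
    aperyTerm (k + j) k =
      (k + j).factorial * (k + j + k).factorial / ((k.factorial : ℝ) ^ 3 * (j.factorial : ℝ) ^ 2) := by
  unfold aperyTerm
  rw [Nat.cast_choose ℝ (Nat.le_add_right k j), Nat.cast_choose ℝ (Nat.le_add_left k (k + j)),
    Nat.add_sub_cancel_left, Nat.add_sub_cancel]
  field_simp

lemma aperyNumber_eq_sum_range {n N : ℕ} (h : n < N) :
    aperyNumber n = ∑ k ∈ Finset.range N, aperyTerm n k := by
  refine Finset.sum_subset (Finset.range_mono h) fun k _ hk => aperyTerm_eq_zero ?_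
  simpa using hk

lemma aperyTerm_certificate (n k : ℕ) (hk : k ≤ n + 1) :
    ((n : ℝ) + 2) ^ 2 * aperyTerm (n + 2) (k + 1)
        - (11 * ((n : ℝ) + 1) ^ 2 + 11 * ((n : ℝ) + 1) + 3) * aperyTerm (n + 1) (k + 1)
        - ((n : ℝ) + 1) ^ 2 * aperyTerm n (k + 1) =
      (((k : ℝ) + 1) ^ 2 + 3 * (2 * n + 3) * (k + 1) - 11 * ((n : ℝ) + 1) ^ 2
          - 9 * ((n : ℝ) + 1) - 2) * aperyTerm (n + 1) (k + 1)
        - ((k : ℝ) ^ 2 + 3 * (2 * n + 3) * k - 11 * ((n : ℝ) + 1) ^ 2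
          - 9 * ((n : ℝ) + 1) - 2) * aperyTerm (n + 1) k := by
  obtain ⟨j, hj⟩ := Nat.exists_eq_add_of_le hk
  have hjR : (n : ℝ) = k + j - 1 := by
    have : (n : ℝ) + 1 = k + j := by exact_mod_cast hj
    linarith
  set e : ℝ := n.factorial * (n + k + 1).factorial /
    (((k + 1).factorial : ℝ) ^ 3 * (j.factorial : ℝ) ^ 2) with he
  have h1 : aperyTerm (n + 2) (k + 1) = (n + 1) * (n + 2) * (n + k + 2) * (n + k + 3) * e := by
    rw [show n + 2 = (k + 1) + j by omega, aperyTerm_add_left,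
      show k + 1 + j + (k + 1) = (n + k + 1) + 1 + 1 by omega, show k + 1 + j = n + 1 + 1 by omega,
      he]
    simp only [Nat.factorial_succ]
    push_cast
    ring
  have h2 : aperyTerm (n + 1) (k + 1) = (n + 1) * (n + k + 2) * j ^ 2 * e := by
    rcases j with _ | j
    · rw [aperyTerm_eq_zero (by omega)]; simp
    · rw [show n + 1 = (k + 1) + j by omega, aperyTerm_add_left,
        show k + 1 + j + (k + 1) = (n + k + 1) + 1 by omega, show k + 1 + j = n + 1 by omega, he]
      simp only [Nat.factorial_succ]
      push_cast
      field_simp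
      ring
  have h3 : aperyTerm n (k + 1) = ((j : ℝ) - 1) ^ 2 * j ^ 2 * e := by
    rcases j with _ | _ | j
    · rw [aperyTerm_eq_zero (by omega)]; simp
    · rw [aperyTerm_eq_zero (by omega)]; simp
    · rw [show n = (k + 1) + j by omega, aperyTerm_add_left,
        show k + 1 + j + (k + 1) = n + k + 1 by omega, show k + 1 + j = n by omega, he]
      simp only [Nat.factorial_succ]
      push_cast
      field_simp
      ring
  have h4 : aperyTerm (n + 1) k = (n + 1) * (k + 1) ^ 3 * e := by
    rw [hj, aperyTerm_add_left,
      show k + j + k = n + k + 1 by omega, show k + j = n + 1 by omega, he]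
    simp only [Nat.factorial_succ]
    push_cast
    field_simp
  rw [h1, h2, h3, h4, hjR]
  ring

lemma aperyNumber_recurrence (n : ℕ) :
    ((n : ℝ) + 2) ^ 2 * aperyNumber (n + 2) =
      (11 * ((n : ℝ) + 1) ^ 2 + 11 * ((n : ℝ) + 1) + 3) * aperyNumber (n + 1)
        + ((n : ℝ) + 1) ^ 2 * aperyNumber n := by
  have key : ∀ K ≤ n + 2, ∑ k ∈ Finset.range (K + 1),
      (((n : ℝ) + 2) ^ 2 * aperyTerm (n + 2) k
        - (11 * ((n : ℝ) + 1) ^ 2 + 11 * ((n : ℝ) + 1) + 3) * aperyTerm (n + 1) k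
        - ((n : ℝ) + 1) ^ 2 * aperyTerm n k) =
      ((K : ℝ) ^ 2 + 3 * (2 * n + 3) * K - 11 * ((n : ℝ) + 1) ^ 2
          - 9 * ((n : ℝ) + 1) - 2) * aperyTerm (n + 1) K := by
    intro K hK
    induction K with
    | zero => simp [aperyTerm_zero_right]; ring
    | succ K ih =>
      rw [Finset.sum_range_succ, ih (by omega), aperyTerm_certificate n K (by omega)]
      push_cast
      ring
  have h := key (n + 2) le_rfl
  rw [aperyTerm_eq_zero (show n + 1 < n + 2 by omega), mul_zero, Finset.sum_sub_distrib,
    Finset.sum_sub_distrib, ← Finset.mul_sum, ← Finset.mul_sum, ← Finset.mul_sum,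
    ← aperyNumber_eq_sum_range (show n + 2 < n + 2 + 1 by omega),
    ← aperyNumber_eq_sum_range (show n + 1 < n + 2 + 1 by omega),
    ← aperyNumber_eq_sum_range (show n < n + 2 + 1 by omega)] at h
  linarith

lemma aperyNumber_zero : aperyNumber 0 = 1 := by simp [aperyNumber, aperyTerm]

lemma aperyNumber_one : aperyNumber 1 = 3 := by
  simp [aperyNumber, aperyTerm, Finset.sum_range_succ]; norm_num

lemma aperyNumber_pos (n : ℕ) : 0 < aperyNumber n := by
  refine Finset.sum_pos' (fun k _ => by unfold aperyTerm; positivity) ⟨0, by simp, ?_⟩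
  simp [aperyTerm]

/-- The summand of the hypergeometric series for the Beukers integral
`∬ (xy(1-x)(1-y))ⁿ / (1-xy)ⁿ⁺¹`. -/
noncomputable def beukersTerm (n k : ℕ) : ℝ :=
  ((n + k).factorial : ℝ) ^ 3 * n.factorial / (k.factorial * ((2 * n + k + 1).factorial : ℝ) ^ 2)

/-- The value of the Beukers integral `∬ (xy(1-x)(1-y))ⁿ / (1-xy)ⁿ⁺¹`, as a series. -/
noncomputable def beukersSum (n : ℕ) : ℝ := ∑' k, beukersTerm n k

lemma beukersTerm_nonneg (n k : ℕ) : 0 ≤ beukersTerm n k := by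
  unfold beukersTerm; positivity

lemma beukersTerm_zero (k : ℕ) : beukersTerm 0 k = 1 / ((k : ℝ) + 1) ^ 2 := by
  simp only [beukersTerm, Nat.factorial_succ, zero_add, mul_zero, Nat.factorial_zero]
  push_cast
  field_simp

lemma beukersTerm_succ_left (n k : ℕ) : beukersTerm (n + 1) k =
    beukersTerm n k * ((n + 1) * (n + k + 1) ^ 3 / ((2 * n + k + 2) ^ 2 * (2 * n + k + 3) ^ 2)) := by
  unfold beukersTerm
  rw [show n + 1 + k = (n + k) + 1 by omega,
    show 2 * (n + 1) + k + 1 = (2 * n + k + 1) + 1 + 1 by omega]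
  simp only [Nat.factorial_succ]
  push_cast
  field_simp
  ring

lemma beukersTerm_succ_right (n k : ℕ) : beukersTerm n (k + 1) =
    beukersTerm n k * ((n + k + 1) ^ 3 / ((k + 1) * (2 * n + k + 2) ^ 2)) := by
  unfold beukersTerm
  rw [show n + (k + 1) = (n + k) + 1 by omega,
    show 2 * n + (k + 1) + 1 = (2 * n + k + 1) + 1 by omega]
  simp only [Nat.factorial_succ]
  push_cast
  field_simp
  ring

lemma beukersTerm_le (n k : ℕ) : beukersTerm n k ≤ n.factorial * (1 / ((k : ℝ) + 1) ^ 2) := by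
  induction n with
  | zero => simp [beukersTerm_zero]
  | succ n ih =>
    rw [beukersTerm_succ_left, Nat.factorial_succ]
    have h : ((n : ℝ) + 1) * (n + k + 1) ^ 3 / ((2 * n + k + 2) ^ 2 * (2 * n + k + 3) ^ 2)
        ≤ n + 1 := by
      rw [div_le_iff₀ (by positivity)]
      gcongr
      have h1 : (n + k + 1 : ℝ) ^ 2 ≤ (2 * n + k + 2) ^ 2 := by gcongr <;> linarith
      have h2 : (n + k + 1 : ℝ) ≤ (2 * n + k + 3) ^ 2 := by nlinarith
      calc (n + k + 1 : ℝ) ^ 3 = (n + k + 1) ^ 2 * (n + k + 1) := by ring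
        _ ≤ _ := by gcongr
    calc _ ≤ (n.factorial * (1 / ((k : ℝ) + 1) ^ 2)) * ((n : ℝ) + 1) := by gcongr
      _ = _ := by push_cast; ring

lemma summable_one_div_add_one_sq : Summable fun k : ℕ => 1 / ((k : ℝ) + 1) ^ 2 := by
  have := (summable_nat_add_iff 1).2 (hasSum_zeta_two.summable)
  simpa using this

lemma summable_beukersTerm (n : ℕ) : Summable (beukersTerm n) :=
  .of_nonneg_of_le (beukersTerm_nonneg n) (beukersTerm_le n)
    (summable_one_div_add_one_sq.mul_left _)

lemma beukersSum_nonneg (n : ℕ) : 0 ≤ beukersSum n := tsum_nonneg (beukersTerm_nonneg n)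

lemma beukersSum_zero : beukersSum 0 = π ^ 2 / 6 := by
  unfold beukersSum
  simp_rw [beukersTerm_zero]
  have := (hasSum_nat_add_iff' 1).2 hasSum_zeta_two
  simpa using this.tsum_eq

lemma tendsto_inv_add_nat (a : ℝ) : Tendsto (fun k : ℕ => ((k : ℝ) + a)⁻¹) atTop (nhds 0) :=
  tendsto_inv_atTop_zero.comp (tendsto_atTop_add_const_right _ _ tendsto_natCast_atTop_atTop)

lemma beukersSum_one : beukersSum 1 = 5 - 3 * (π ^ 2 / 6) := by
  set H : ℕ → ℝ := fun k => 3 * ((k : ℝ) + 2)⁻¹ + 3 * ((k : ℝ) + 1)⁻¹ ^ 2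
    + 2 * ((k : ℝ) + 2)⁻¹ ^ 2 with hH
  have hlim : Tendsto H atTop (nhds 0) := by
    have := (((tendsto_inv_add_nat 2).const_mul 3).add
      (((tendsto_inv_add_nat 1).pow 2).const_mul 3)).add
      (((tendsto_inv_add_nat 2).pow 2).const_mul 2)
    simpa [hH] using this
  have hterm : ∀ k, beukersTerm 1 k + 3 * beukersTerm 0 k = H k - H (k + 1) := by
    intro k
    rw [show beukersTerm 1 k = _ from beukersTerm_succ_left 0 k, beukersTerm_zero, hH]
    push_cast
    field_simp
    ring
  have hs := (summable_beukersTerm 1).hasSum.add ((summable_beukersTerm 0).hasSum.mul_left 3)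
  have ht := hs.tendsto_sum_nat
  simp_rw [hterm, Finset.sum_range_sub'] at ht
  have := tendsto_nhds_unique ht (hlim.const_sub (H 0))
  have h0 : H 0 = 5 := by simp [hH]; norm_num
  change beukersSum 1 + 3 * beukersSum 0 = _ at this
  rw [beukersSum_zero, h0] at this
  linarith

/-- The coefficients in `k` of the polynomial in Zeilberger's certificate for `beukersTerm`. -/
def beukersCoeff (n : ℝ) : ℕ → ℝ
  | 0 => -840 - 4388 * n - 9678 * n ^ 2 - 11679 * n ^ 3 - 8328 * n ^ 4 - 3510 * n ^ 5
      - 810 * n ^ 6 - 79 * n ^ 7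
  | 1 => -1760 - 7720 * n - 13902 * n ^ 2 - 13159 * n ^ 3 - 6909 * n ^ 4 - 1909 * n ^ 5
      - 217 * n ^ 6
  | 2 => -1317 - 4744 * n - 6744 * n ^ 2 - 4733 * n ^ 3 - 1641 * n ^ 4 - 225 * n ^ 5
  | 3 => -397 - 1155 * n - 1240 * n ^ 2 - 584 * n ^ 3 - 102 * n ^ 4
  | 4 => -30 - 69 * n - 52 * n ^ 2 - 13 * n ^ 3
  | 5 => 7 + 11 * n + 4 * n ^ 2
  | 6 => 1 + n
  | _ => 0

/-- The polynomial in Zeilberger's certificate for `beukersTerm`. -/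
def beukersPoly (n k : ℝ) : ℝ := ∑ j ∈ Finset.range 7, beukersCoeff n j * k ^ j

/-- Zeilberger's certificate for `beukersTerm`. -/
noncomputable def beukersCert (n k : ℕ) : ℝ :=
  beukersTerm n k * (k * beukersPoly n k /
    ((2 * n + k + 2) * (2 * n + k + 3) * (2 * n + k + 4)) ^ 2)

lemma beukersTerm_certificate (n k : ℕ) :
    ((n : ℝ) + 2) ^ 2 * beukersTerm (n + 2) k
        + (11 * ((n : ℝ) + 1) ^ 2 + 11 * ((n : ℝ) + 1) + 3) * beukersTerm (n + 1) k
        - ((n : ℝ) + 1) ^ 2 * beukersTerm n k =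
      beukersCert n (k + 1) - beukersCert n k := by
  unfold beukersCert
  rw [show n + 2 = (n + 1) + 1 from rfl, beukersTerm_succ_left (n + 1), beukersTerm_succ_left n,
    beukersTerm_succ_right]
  generalize beukersTerm n k = t
  simp only [beukersPoly, Finset.sum_range_succ, Finset.sum_range_zero, beukersCoeff]
  push_cast
  field_simp
  ring

lemma tendsto_beukersCert (n : ℕ) : Tendsto (beukersCert n) atTop (nhds 0) := by
  obtain ⟨C, hC0, hC⟩ : ∃ C : ℝ, 0 ≤ C ∧ ∀ k : ℕ, |beukersPoly n k| ≤ C * ((k : ℝ) + 1) ^ 6 := by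
    have aux : ∀ (c : ℝ) (j : ℕ), j ≤ 6 → ∀ k : ℕ, |c * (k : ℝ) ^ j| ≤ |c| * ((k : ℝ) + 1) ^ 6 := by
      intro c j hj k
      rw [abs_mul, abs_of_nonneg (by positivity : (0 : ℝ) ≤ (k : ℝ) ^ j)]
      gcongr
      calc (k : ℝ) ^ j ≤ (k + 1) ^ j := by gcongr; linarith
        _ ≤ _ := pow_le_pow_right₀ (by linarith [Nat.cast_nonneg (α := ℝ) k]) hj
    refine ⟨∑ j ∈ Finset.range 7, |beukersCoeff n j|, by positivity, fun k => ?_⟩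
    rw [beukersPoly, Finset.sum_mul]
    refine (Finset.abs_sum_le_sum_abs _ _).trans (Finset.sum_le_sum fun j hj => aux _ _ ?_ _)
    simp at hj
    omega
  have hb : ∀ k, ‖beukersCert n k‖ ≤ n.factorial * C * ((k : ℝ) + 1)⁻¹ := by
    intro k
    unfold beukersCert
    rw [Real.norm_eq_abs, abs_mul, abs_of_nonneg (beukersTerm_nonneg n k), abs_div, abs_mul,
      abs_of_nonneg (Nat.cast_nonneg (α := ℝ) k),
      abs_of_nonneg (by positivity :
        (0 : ℝ) ≤ ((2 * n + k + 2) * (2 * n + k + 3) * (2 * n + k + 4)) ^ 2)]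
    have h1 : (k : ℝ) * |beukersPoly n k| /
        ((2 * n + k + 2) * (2 * n + k + 3) * (2 * n + k + 4)) ^ 2 ≤ C * (k + 1) := by
      rw [div_le_iff₀ (by positivity)]
      calc (k : ℝ) * |beukersPoly n k| ≤ (k + 1) * (C * ((k : ℝ) + 1) ^ 6) := by
            gcongr
            · linarith
            · exact hC k
        _ = C * (k + 1) * (((k + 1) * (k + 1) * (k + 1)) ^ 2) := by ring
        _ ≤ _ := by
            have : (0 : ℝ) ≤ n := by positivity
            gcongr <;> linarith
    calc _ ≤ (n.factorial * (1 / ((k : ℝ) + 1) ^ 2)) * (C * (k + 1)) := by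
          gcongr
          exact beukersTerm_le n k
      _ = _ := by field_simp
  refine squeeze_zero_norm hb ?_
  simpa using (tendsto_inv_add_nat 1).const_mul (n.factorial * C)

lemma beukersSum_recurrence (n : ℕ) :
    ((n : ℝ) + 2) ^ 2 * beukersSum (n + 2) =
      -(11 * ((n : ℝ) + 1) ^ 2 + 11 * ((n : ℝ) + 1) + 3) * beukersSum (n + 1)
        + ((n : ℝ) + 1) ^ 2 * beukersSum n := by
  have hs := (((summable_beukersTerm (n + 2)).hasSum.mul_left (((n : ℝ) + 2) ^ 2)).add
    ((summable_beukersTerm (n + 1)).hasSum.mul_left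
      (11 * ((n : ℝ) + 1) ^ 2 + 11 * ((n : ℝ) + 1) + 3))).sub
    ((summable_beukersTerm n).hasSum.mul_left (((n : ℝ) + 1) ^ 2))
  have ht := hs.tendsto_sum_nat
  simp_rw [beukersTerm_certificate, Finset.sum_range_sub] at ht
  have h := tendsto_nhds_unique ht ((tendsto_beukersCert n).sub_const (beukersCert n 0))
  have h0 : beukersCert n 0 = 0 := by simp [beukersCert]
  change _ * beukersSum (n + 2) + _ * beukersSum (n + 1) - _ * beukersSum n = _ at h
  rw [h0] at h
  linarith

section

open MeasureTheory

/-- The point `e^{is}` of the unit circle. -/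
noncomputable def expI (s : ℝ) : ℂ := Complex.exp (s * Complex.I)

lemma continuous_expI : Continuous expI := by unfold expI; fun_prop

lemma expI_mul_expI_neg (s : ℝ) : expI s * expI (-s) = 1 := by
  simp [expI, ← Complex.exp_add]

lemma norm_expI (s : ℝ) : ‖expI s‖ = 1 := Complex.norm_exp_ofReal_mul_I s

lemma integral_expI_pow_mul_expI_neg_pow (j l : ℕ) :
    ∫ s in Set.Ioc (-π) π, expI s ^ j * expI (-s) ^ l = if j = l then 2 * (π : ℂ) else 0 := by
  rw [← intervalIntegral.integral_of_le (by linarith [pi_pos])]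
  split_ifs with h
  · subst h
    simp only [← mul_pow, expI_mul_expI_neg, one_pow, intervalIntegral.integral_const]
    simp only [sub_neg_eq_add, Complex.real_smul, mul_one]
    push_cast
    ring
  · have hc : ((j : ℂ) - l) * Complex.I ≠ 0 :=
      mul_ne_zero (sub_ne_zero.2 (by exact_mod_cast h)) Complex.I_ne_zero
    have hf : ∀ s : ℝ, expI s ^ j * expI (-s) ^ l =
        Complex.exp (((j : ℂ) - l) * Complex.I * s) := by
      intro s
      rw [expI, expI, ← Complex.exp_nat_mul, ← Complex.exp_nat_mul, ← Complex.exp_add]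
      congr 1
      push_cast
      ring
    simp_rw [hf]
    rw [integral_exp_mul_complex hc, div_eq_zero_iff]
    left
    rw [sub_eq_zero, Complex.exp_eq_exp_iff_exists_int]
    refine ⟨(j : ℤ) - l, ?_⟩
    push_cast
    ring

lemma integral_add_expI_pow_mul_expI_neg_pow (p : ℂ) (m l : ℕ) :
    ∫ s in Set.Ioc (-π) π, (p + expI s) ^ m * expI (-s) ^ l =
      2 * π * m.choose l * p ^ (m - l) := by
  have hf : ∀ s, (p + expI s) ^ m * expI (-s) ^ l = ∑ j ∈ Finset.range (m + 1),
      p ^ (m - j) * m.choose j * (expI s ^ j * expI (-s) ^ l) := by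
    intro s
    rw [add_comm, add_pow, Finset.sum_mul]
    exact Finset.sum_congr rfl fun j _ => by ring
  simp_rw [hf]
  have hcont : ∀ j : ℕ, Continuous fun s => p ^ (m - j) * (m.choose j : ℂ) *
      (expI s ^ j * expI (-s) ^ l) := by
    have := continuous_expI
    intro j
    fun_prop
  rw [integral_finsetSum _ fun j _ => (hcont j).integrableOn_Ioc]
  simp_rw [integral_const_mul, integral_expI_pow_mul_expI_neg_pow, mul_ite, mul_zero]
  rw [Finset.sum_ite_eq']
  split_ifs with h
  · ring
  · rw [Nat.choose_eq_zero_of_lt (by simpa using h)]; simp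

/-- The characteristic function of the random walk attached to the Laurent polynomial
`(1+x)(1+y)(1+x+y)/(xy)`, tilted to its critical point `x = y = p⁻¹`. -/
noncomputable def walkChar (p : ℝ) (z : ℝ × ℝ) : ℂ :=
  p ^ 4 * (p + expI z.1) * (p + expI z.2) * (p + expI z.1 + expI z.2)
    * (expI (-z.1) * expI (-z.2))

lemma continuous_walkChar (p : ℝ) : Continuous (walkChar p) := by
  have := continuous_expI
  unfold walkChar
  fun_prop

lemma setIntegral_walkChar_pow (p : ℝ) (n : ℕ) :
    ∫ z in Set.Ioc (-π) π ×ˢ Set.Ioc (-π) π, walkChar p z ^ n =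
      (((2 * π) ^ 2 * p ^ (5 * n) * aperyNumber n : ℝ) : ℂ) := by
  have hf : ∀ z, walkChar p z ^ n = ∑ k ∈ Finset.range (n + 1), (p : ℂ) ^ (4 * n) * n.choose k *
      (((p + expI z.1) ^ (2 * n - k) * expI (-z.1) ^ n) *
        ((p + expI z.2) ^ n * expI (-z.2) ^ (n - k))) := by
    intro z
    rw [walkChar, mul_pow, mul_pow, mul_pow, mul_pow, add_comm ((p : ℂ) + expI z.1) (expI z.2),
      add_pow (expI z.2),
      Finset.mul_sum, Finset.sum_mul]
    refine Finset.sum_congr rfl fun k hk => ?_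
    have hk : k ≤ n := by simpa [Nat.lt_succ_iff] using hk
    have h1 : (p + expI z.1) ^ (2 * n - k) = (p + expI z.1) ^ n * (p + expI z.1) ^ (n - k) := by
      rw [← pow_add]; congr 1; omega
    have h2 : expI (-z.2) ^ n = expI (-z.2) ^ (n - k) * expI (-z.2) ^ k := by
      rw [← pow_add]; congr 1; omega
    have h3 : expI z.2 ^ k * expI (-z.2) ^ k = 1 := by
      rw [← mul_pow, expI_mul_expI_neg, one_pow]
    rw [h1, mul_pow (expI _), h2]
    linear_combination (p : ℂ) ^ (4 * n) * n.choose k * (p + expI z.1) ^ n *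
      (p + expI z.1) ^ (n - k) * expI (-z.1) ^ n * (p + expI z.2) ^ n * expI (-z.2) ^ (n - k) * h3
  simp_rw [hf]
  have hcont : ∀ k, Continuous fun z : ℝ × ℝ => (p : ℂ) ^ (4 * n) * n.choose k *
      (((p + expI z.1) ^ (2 * n - k) * expI (-z.1) ^ n) *
        ((p + expI z.2) ^ n * expI (-z.2) ^ (n - k))) := by
    have := continuous_expI
    intro k
    fun_prop
  rw [integral_finsetSum]
  swap
  · intro k _
    exact ((hcont k).continuousOn.integrableOn_compact
      (isCompact_Icc.prod isCompact_Icc : IsCompact (Set.Icc (-π) π ×ˢ Set.Icc (-π) π))).mono_set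
        (Set.prod_mono Set.Ioc_subset_Icc_self Set.Ioc_subset_Icc_self)
  simp_rw [integral_const_mul]
  have hprod : ∀ k, ∫ z in Set.Ioc (-π) π ×ˢ Set.Ioc (-π) π,
      (((p + expI z.1) ^ (2 * n - k) * expI (-z.1) ^ n) *
        ((p + expI z.2) ^ n * expI (-z.2) ^ (n - k))) =
      (2 * π * (2 * n - k).choose n * p ^ (2 * n - k - n)) *
        (2 * π * n.choose (n - k) * p ^ (n - (n - k))) := by
    intro k
    rw [Measure.volume_eq_prod, setIntegral_prod_mul
      (fun s => (p + expI s) ^ (2 * n - k) * expI (-s) ^ n)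
      (fun s => (p + expI s) ^ n * expI (-s) ^ (n - k)),
      integral_add_expI_pow_mul_expI_neg_pow, integral_add_expI_pow_mul_expI_neg_pow]
  simp_rw [hprod]
  rw [aperyNumber, ← Finset.sum_flip, Finset.mul_sum, Complex.ofReal_sum]
  refine Finset.sum_congr rfl fun k hk => ?_
  have hk : k ≤ n := by simpa [Nat.lt_succ_iff] using hk
  rw [aperyTerm, Nat.choose_symm hk, show n - (n - k) = k by omega,
    show 2 * n - (n - k) = n + k by omega,
    Nat.add_sub_cancel_left, Nat.choose_symm_of_eq_add (rfl : n + k = n + k),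
    show 5 * n = 4 * n + k + (n - k) by omega]
  push_cast
  ring

lemma norm_mul_add_expI_le {p : ℝ} (hp0 : 0 < p) (hp : p ^ 2 + p = 1) {s : ℝ} (hs : |s| ≤ π) :
    ‖(p : ℂ) * (p + expI s)‖ ≤ rexp (-(2 * p ^ 3 / π ^ 2) * s ^ 2) := by
  refine le_of_sq_le_sq ?_ (exp_pos _).le
  have h1 : ‖(p : ℂ) * (p + expI s)‖ ^ 2 = 1 - 2 * p ^ 3 * (1 - cos s) := by
    rw [Complex.sq_norm, expI, Complex.exp_mul_I, Complex.normSq_apply]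
    simp only [Complex.mul_re, Complex.mul_im, Complex.add_re, Complex.add_im, Complex.ofReal_re,
      Complex.ofReal_im, ← Complex.ofReal_cos, ← Complex.ofReal_sin, Complex.I_re, Complex.I_im]
    linear_combination p ^ 2 * sin_sq_add_cos_sq s + (p ^ 2 + p + 1) * hp
  rw [h1, ← exp_nat_mul]
  have h2 := cos_le_one_sub_mul_cos_sq hs
  have h3 := add_one_le_exp ((2 : ℕ) * (-(2 * p ^ 3 / π ^ 2) * s ^ 2))
  refine le_trans ?_ h3
  have h4 : 2 * p ^ 3 * (2 / π ^ 2 * s ^ 2) ≤ 2 * p ^ 3 * (1 - cos s) := by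
    gcongr
    linarith
  have h5 : ((2 : ℕ) : ℝ) * (-(2 * p ^ 3 / π ^ 2) * s ^ 2) = -(2 * p ^ 3 * (2 / π ^ 2 * s ^ 2)) := by
    push_cast
    ring
  linarith

lemma norm_walkChar_le {p : ℝ} (hp0 : 0 < p) (hp : p ^ 2 + p = 1) {z : ℝ × ℝ}
    (hz : z ∈ Set.Ioc (-π) π ×ˢ Set.Ioc (-π) π) :
    ‖walkChar p z‖ ≤
      rexp (-(2 * p ^ 3 / π ^ 2) * z.1 ^ 2) * rexp (-(2 * p ^ 3 / π ^ 2) * z.2 ^ 2) := by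
  have h1 := norm_mul_add_expI_le hp0 hp (abs_le.2 ⟨hz.1.1.le, hz.1.2⟩)
  have h2 := norm_mul_add_expI_le hp0 hp (abs_le.2 ⟨hz.2.1.le, hz.2.2⟩)
  have h3 : ‖(p : ℂ) ^ 2 * (p + expI z.1 + expI z.2)‖ ≤ 1 := by
    rw [norm_mul, norm_pow, Complex.norm_of_nonneg hp0.le]
    have : ‖(p : ℂ) + expI z.1 + expI z.2‖ ≤ p + 1 + 1 := by
      refine (norm_add₃_le).trans ?_
      rw [norm_expI, norm_expI, Complex.norm_of_nonneg hp0.le]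
    calc _ ≤ p ^ 2 * (p + 1 + 1) := by gcongr
      _ = 1 := by linear_combination (p + 1) * hp
  have h4 : walkChar p z = ((p : ℂ) * (p + expI z.1)) * ((p : ℂ) * (p + expI z.2)) *
      ((p : ℂ) ^ 2 * (p + expI z.1 + expI z.2)) * (expI (-z.1) * expI (-z.2)) := by
    unfold walkChar; ring
  rw [h4, norm_mul, norm_mul, norm_mul, norm_mul (expI _), norm_expI, norm_expI, one_mul, mul_one]
  refine (mul_le_of_le_one_right (by positivity) h3).trans ?_
  gcongr

lemma tendsto_sqrt_mul_expI_sub_one (s : ℝ) :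
    Tendsto (fun n : ℕ => ((√n : ℝ) : ℂ) * (expI ((√n)⁻¹ * s) - 1)) atTop
      (nhds (s * Complex.I)) := by
  have hd : HasDerivAt (fun h : ℝ => expI (h * s)) (s * Complex.I) 0 := by
    have h1 : HasDerivAt (fun h : ℝ => ((h * s : ℝ) : ℂ) * Complex.I) (s * Complex.I) 0 := by
      simpa using (((hasDerivAt_id (0 : ℝ)).mul_const s).ofReal_comp).mul_const Complex.I
    simpa [expI] using h1.cexp
  have hs : Tendsto (fun n : ℕ => (√n)⁻¹) atTop (nhdsWithin 0 {0}ᶜ) := by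
    refine tendsto_nhdsWithin_iff.2 ⟨tendsto_inv_atTop_zero.comp
      (tendsto_sqrt_atTop.comp tendsto_natCast_atTop_atTop), ?_⟩
    filter_upwards [eventually_gt_atTop 0] with n hn
    have : 0 < √(n : ℝ) := sqrt_pos.2 (by exact_mod_cast hn)
    simp [this.ne']
  have := hd.tendsto_slope_zero.comp hs
  simpa [Function.comp_def, expI] using this

lemma tendsto_walkChar_pow {p : ℝ} (hp : p ^ 2 + p = 1) (z : ℝ × ℝ) :
    Tendsto (fun n : ℕ => walkChar p ((√n)⁻¹ • z) ^ n) atTop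
      (nhds ((rexp (-(p ^ 3 * (z.1 ^ 2 + z.2 ^ 2) - p ^ 4 * (z.1 * z.2))) : ℝ) : ℂ)) := by
  have hpC : (p : ℂ) ^ 2 + p = 1 := by exact_mod_cast hp
  have hexp : ∀ z : ℝ × ℝ, walkChar p z = 1 +
      (-p * ((expI z.1 - 1) * (expI z.2 - 1)) + p ^ 3 * (expI z.1 - 1 + (expI z.2 - 1)) ^ 2
        + p ^ 4 * ((expI z.1 - 1) * (expI z.2 - 1) * (expI z.1 - 1 + (expI z.2 - 1))))
        * (expI (-z.1) * expI (-z.2)) := by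
    intro z
    have h1 := expI_mul_expI_neg z.1
    have h2 := expI_mul_expI_neg z.2
    have h3 : expI z.1 * expI z.2 * (expI (-z.1) * expI (-z.2)) = 1 := by
      linear_combination expI z.2 * expI (-z.2) * h1 + h2
    have h4 : (p : ℂ) * (p + expI z.1) = 1 + p * (expI z.1 - 1) := by linear_combination hpC
    have h5 : (p : ℂ) * (p + expI z.2) = 1 + p * (expI z.2 - 1) := by linear_combination hpC
    have h6 : (p : ℂ) ^ 2 * (p + expI z.1 + expI z.2) =
        1 + p ^ 2 * (expI z.1 - 1 + (expI z.2 - 1)) := by linear_combination (p + 1) * hpC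
    calc walkChar p z = (p * (p + expI z.1)) * (p * (p + expI z.2)) *
          (p ^ 2 * (p + expI z.1 + expI z.2)) * (expI (-z.1) * expI (-z.2)) := by
          unfold walkChar; ring
      _ = _ := by
          rw [h4, h5, h6]
          linear_combination (expI (-z.1) * expI (-z.2)) * (expI z.1 * expI z.2 - 1) * hpC + h3
  simp_rw [hexp]
  rw [Complex.ofReal_exp]
  refine Complex.tendsto_one_add_pow_exp_of_tendsto ?_
  have hU := tendsto_sqrt_mul_expI_sub_one z.1
  have hV := tendsto_sqrt_mul_expI_sub_one z.2
  have h0 : Tendsto (fun n : ℕ => (√n)⁻¹) atTop (nhds 0) :=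
    tendsto_inv_atTop_zero.comp (tendsto_sqrt_atTop.comp tendsto_natCast_atTop_atTop)
  have hE : ∀ s : ℝ, Tendsto (fun n : ℕ => expI ((√n)⁻¹ * s)) atTop (nhds 1) := by
    intro s
    have := (continuous_expI.tendsto 0).comp (by simpa using h0.mul_const s :
      Tendsto (fun n : ℕ => (√n)⁻¹ * s) atTop (nhds 0))
    simpa [expI, Function.comp_def] using this
  have hW : Tendsto (fun n : ℕ => expI ((√n)⁻¹ * z.1) - 1 + (expI ((√n)⁻¹ * z.2) - 1)) atTop
      (nhds 0) := by
    simpa using ((hE z.1).sub_const 1).add ((hE z.2).sub_const 1)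
  have hlim := ((((hU.mul hV).const_mul (-(p : ℂ))).add (((hU.add hV).pow 2).const_mul
    ((p : ℂ) ^ 3))).add (((hU.mul hV).mul hW).const_mul ((p : ℂ) ^ 4))).mul
      ((hE (-z.1)).mul (hE (-z.2)))
  convert! hlim using 2 with n
  · have hn : ((√n : ℝ) : ℂ) ^ 2 = n := by
      exact_mod_cast congrArg Complex.ofReal (sq_sqrt (Nat.cast_nonneg n))
    simp only [Prod.smul_fst, Prod.smul_snd, smul_eq_mul, mul_neg]
    rw [← hn]
    ring
  · push_cast
    linear_combination (p * (p + 1) * z.1 * z.2 : ℂ) * hpC +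
      (p * z.1 * z.2 - p ^ 3 * (z.1 + z.2) ^ 2 : ℂ) * Complex.I_sq

lemma integral_exp_neg_quadratic {a b : ℝ} (hb : 0 ≤ b) (hab : b < 2 * a) :
    ∫ z : ℝ × ℝ, rexp (-(a * (z.1 ^ 2 + z.2 ^ 2) - b * (z.1 * z.2))) =
      2 * π / √(4 * a ^ 2 - b ^ 2) := by
  have ha : 0 < a := by linarith
  have hf_int : Integrable (fun z : ℝ × ℝ => rexp (-(a * (z.1 ^ 2 + z.2 ^ 2) - b * (z.1 * z.2)))) := by
    have hc : 0 < a - b / 2 := by linarith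
    have hg := (integrable_exp_neg_mul_sq hc).mul_prod (integrable_exp_neg_mul_sq hc)
    refine hg.mono' (by fun_prop) (Eventually.of_forall fun z => ?_)
    rw [Real.norm_of_nonneg (exp_pos _).le, ← exp_add]
    refine exp_le_exp.2 ?_
    nlinarith [mul_nonneg hb (sq_nonneg (z.1 - z.2))]
  have hsq : ∀ x y : ℝ, rexp (-(a * (x ^ 2 + y ^ 2) - b * (x * y))) =
      rexp (-(a - b ^ 2 / (4 * a)) * x ^ 2) * rexp (-a * (y - b * x / (2 * a)) ^ 2) := by
    intro x y
    rw [← exp_add]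
    congr 1
    field_simp
    ring
  rw [Measure.volume_eq_prod, integral_prod _ hf_int]
  simp_rw [hsq, integral_const_mul]
  have hin : ∀ x : ℝ, ∫ y : ℝ, rexp (-a * (y - b * x / (2 * a)) ^ 2) = √(π / a) := by
    intro x
    rw [integral_sub_right_eq_self (fun y => rexp (-a * y ^ 2)) (b * x / (2 * a)),
      integral_gaussian]
  simp_rw [hin]
  rw [integral_mul_const, integral_gaussian]
  have hd : 0 < 4 * a ^ 2 - b ^ 2 := by nlinarith
  have hd' : a - b ^ 2 / (4 * a) = (4 * a ^ 2 - b ^ 2) / (4 * a) := by field_simp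
  rw [hd', ← sqrt_mul (by positivity), eq_div_iff (by positivity), ← sqrt_mul (by positivity),
    show π / ((4 * a ^ 2 - b ^ 2) / (4 * a)) * (π / a) * (4 * a ^ 2 - b ^ 2) = (2 * π) ^ 2 by
      field_simp; ring]
  exact sqrt_sq (by positivity)

lemma tendsto_mul_pow_mul_aperyNumber {p : ℝ} (hp0 : 0 < p) (hp : p ^ 2 + p = 1) :
    Tendsto (fun n : ℕ => n * p ^ (5 * n) * aperyNumber n) atTop
      (nhds (1 / (2 * π * √(4 * p ^ 6 - p ^ 8)))) := by
  set S : Set (ℝ × ℝ) := Set.Ioc (-π) π ×ˢ Set.Ioc (-π) π with hS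
  have hSm : MeasurableSet S := measurableSet_Ioc.prod measurableSet_Ioc
  set c : ℝ := 2 * p ^ 3 / π ^ 2 with hc
  have hc0 : 0 < c := by positivity
  set F : ℕ → ℝ × ℝ → ℂ := fun n z => S.indicator (fun w => walkChar p w ^ n) ((√n)⁻¹ • z) with hF
  have hFint : ∀ n : ℕ, ∫ z, F n z =
      (((2 * π) ^ 2 * (n * p ^ (5 * n) * aperyNumber n) : ℝ) : ℂ) := by
    intro n
    rw [hF]
    simp only
    rw [Measure.integral_comp_smul volume (S.indicator fun w => walkChar p w ^ n),
      integral_indicator hSm, setIntegral_walkChar_pow]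
    simp only [Module.finrank_prod, Module.finrank_self, inv_pow, inv_inv]
    rw [sq_sqrt (Nat.cast_nonneg n), abs_of_nonneg (Nat.cast_nonneg n), Complex.real_smul]
    push_cast
    ring
  have hbound : ∀ n : ℕ, 0 < n → ∀ z, ‖F n z‖ ≤ rexp (-c * z.1 ^ 2) * rexp (-c * z.2 ^ 2) := by
    intro n hn z
    simp only [hF]
    by_cases hz : (√n)⁻¹ • z ∈ S
    · rw [Set.indicator_of_mem hz, norm_pow]
      refine (pow_le_pow_left₀ (norm_nonneg _) (norm_walkChar_le hp0 hp hz) n).trans_eq ?_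
      have hsq : (n : ℝ) * (√n)⁻¹ ^ 2 = 1 := by
        rw [inv_pow, sq_sqrt (Nat.cast_nonneg n)]
        exact mul_inv_cancel₀ (by exact_mod_cast hn.ne')
      rw [mul_pow, ← exp_nat_mul, ← exp_nat_mul, ← hc]
      simp only [Prod.smul_fst, Prod.smul_snd, smul_eq_mul]
      congr 2
      · linear_combination (-c * z.1 ^ 2) * hsq
      · linear_combination (-c * z.2 ^ 2) * hsq
    · rw [Set.indicator_of_notMem hz, norm_zero]
      positivity
  have hlim := tendsto_integral_filter_of_dominated_convergence (μ := volume) (F := F) (l := atTop)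
    (f := fun z => ((rexp (-(p ^ 3 * (z.1 ^ 2 + z.2 ^ 2) - p ^ 4 * (z.1 * z.2))) : ℝ) : ℂ))
    (fun z : ℝ × ℝ => rexp (-c * z.1 ^ 2) * rexp (-c * z.2 ^ 2)) (Eventually.of_forall ?_)
    ((eventually_gt_atTop 0).mono fun n hn => Eventually.of_forall (hbound n hn))
    ((integrable_exp_neg_mul_sq hc0).mul_prod (integrable_exp_neg_mul_sq hc0))
    (Eventually.of_forall fun z => ?_)
  · simp_rw [hFint] at hlim
    have hgauss : ∫ z : ℝ × ℝ,
        ((rexp (-(p ^ 3 * (z.1 ^ 2 + z.2 ^ 2) - p ^ 4 * (z.1 * z.2))) : ℝ) : ℂ) =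
        ((2 * π / √(4 * (p ^ 3) ^ 2 - (p ^ 4) ^ 2) : ℝ) : ℂ) := by
      rw [← integral_exp_neg_quadratic (by positivity) (by nlinarith [pow_pos hp0 3])]
      exact integral_ofReal
    rw [hgauss] at hlim
    have hre := ((Complex.continuous_re.tendsto _).comp hlim).const_mul (((2 * π) ^ 2)⁻¹)
    simp only [Function.comp_def, Complex.ofReal_re] at hre
    convert! hre using 2 with n
    · field_simp
    · rw [show (p ^ 3) ^ 2 = p ^ 6 by ring, show (p ^ 4) ^ 2 = p ^ 8 by ring]
      field_simp
  · intro n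
    have : Measurable (F n) :=
      (((continuous_walkChar p).pow n).measurable.indicator hSm).comp (by fun_prop)
    exact this.aestronglyMeasurable
  · refine (tendsto_walkChar_pow hp z).congr' ?_
    have h0 : Tendsto (fun n : ℕ => (√n)⁻¹ • z) atTop (nhds 0) := by
      simpa using (tendsto_inv_atTop_zero.comp
        (tendsto_sqrt_atTop.comp tendsto_natCast_atTop_atTop)).smul_const z
    have hS0 : S ∈ nhds (0 : ℝ × ℝ) :=
      prod_mem_nhds (Ioc_mem_nhds (by simp [pi_pos]) pi_pos)
        (Ioc_mem_nhds (by simp [pi_pos]) pi_pos)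
    filter_upwards [h0 hS0] with n hn
    rw [hF]
    exact (Set.indicator_of_mem hn _).symm

end

lemma beukersSum_casoratian (n : ℕ) :
    beukersSum n * aperyNumber (n + 1) + beukersSum (n + 1) * aperyNumber n =
      5 / ((n : ℝ) + 1) ^ 2 := by
  induction n with
  | zero =>
    rw [zero_add, beukersSum_zero, beukersSum_one, aperyNumber_zero, aperyNumber_one]
    push_cast
    ring
  | succ n ih =>
    have hb := aperyNumber_recurrence n
    have hR := beukersSum_recurrence n
    rw [eq_div_iff (by positivity)] at ih ⊢
    push_cast
    linear_combination beukersSum (n + 1) * hb + aperyNumber (n + 1) * hR + ih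

/-- A bounded solution of `w n = 1 - d n * w (n + 1)`, with `d n → δ` and `|δ| < 1`, converges. -/
lemma tendsto_of_backward_recurrence {w d : ℕ → ℝ} {δ B : ℝ} (hδ : |δ| < 1)
    (hw : ∀ n, |w n| ≤ B) (hd : Tendsto d atTop (nhds δ)) (h : ∀ n, w n = 1 - d n * w (n + 1)) :
    Tendsto w atTop (nhds (1 / (1 + δ))) := by
  have hδ' : 1 + δ ≠ 0 := by linarith [(abs_lt.1 hδ).1]
  set L := 1 / (1 + δ) with hL
  have hLeq : L = 1 - δ * L := by rw [hL]; field_simp; ring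
  have hB : 0 ≤ B := (abs_nonneg _).trans (hw 0)
  set e : ℕ → ℝ := fun n => |δ - d n| * B with he
  have hstep : ∀ n, |w n - L| ≤ |δ| * |w (n + 1) - L| + e n := by
    intro n
    have : w n - L = -(δ * (w (n + 1) - L)) + (δ - d n) * w (n + 1) := by
      rw [h n]; linear_combination -hLeq
    rw [this]
    refine (abs_add_le _ _).trans ?_
    rw [abs_neg, abs_mul, abs_mul]
    exact add_le_add_right (mul_le_mul_of_nonneg_left (hw _) (abs_nonneg _)) _
  have he0 : Tendsto e atTop (nhds 0) := by
    simpa using ((hd.const_sub δ).abs).mul_const B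
  rw [Metric.tendsto_atTop]
  intro ε hε
  have h1 : 0 < 1 - |δ| := by linarith
  obtain ⟨N, hN⟩ := (Metric.tendsto_atTop.1 he0) (ε / 2 * (1 - |δ|)) (by positivity)
  refine ⟨N, fun n hn => ?_⟩
  have hiter : ∀ k n, N ≤ n → |w n - L| ≤ |δ| ^ k * (B + |L|) + ε / 2 := by
    intro k
    induction k with
    | zero =>
      intro n _
      have := abs_sub (w n) L
      have := hw n
      rw [pow_zero]
      linarith
    | succ k ih =>
      intro n hn
      have h2 : e n ≤ ε / 2 * (1 - |δ|) := by
        have := hN n hn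
        rw [Real.dist_eq, sub_zero] at this
        exact (le_abs_self _).trans this.le
      calc _ ≤ |δ| * |w (n + 1) - L| + e n := hstep n
        _ ≤ |δ| * (|δ| ^ k * (B + |L|) + ε / 2) + ε / 2 * (1 - |δ|) := by
            gcongr
            exact ih (n + 1) (by omega)
        _ = _ := by ring
  have hlim : Tendsto (fun k : ℕ => |δ| ^ k * (B + |L|) + ε / 2) atTop (nhds (ε / 2)) := by
    simpa using ((tendsto_pow_atTop_nhds_zero_of_lt_one (abs_nonneg δ) hδ).mul_const
      (B + |L|)).add_const (ε / 2)
  have := ge_of_tendsto' hlim fun k => hiter k n hn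
  rw [Real.dist_eq]
  linarith

lemma tendsto_natCast_div_add_one : Tendsto (fun n : ℕ => (n : ℝ) / (n + 1)) atTop (nhds 1) :=
  tendsto_natCast_div_add_atTop 1

/-- The ratio `beukersSum n / aperyNumber n` decays like `4π²φ^{-5}·φ^{-10n}`, where `p = φ⁻¹`. -/
lemma tendsto_beukersSum_div_aperyNumber {p : ℝ} (hp0 : 0 < p) (hp : p ^ 2 + p = 1) :
    Tendsto (fun n : ℕ => beukersSum n / aperyNumber n / p ^ (10 * n)) atTop
      (nhds (4 * π ^ 2 * p ^ 5)) := by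
  have hp1 : p < 1 := by nlinarith
  have hb := aperyNumber_pos
  have hD : 0 < 4 * p ^ 6 - p ^ 8 := by
    have : p ^ 8 < p ^ 6 := pow_lt_pow_right_of_lt_one₀ hp0 hp1 (by norm_num)
    have := pow_pos hp0 6
    linarith
  set C : ℝ := 1 / (2 * π * √(4 * p ^ 6 - p ^ 8)) with hC
  have hC0 : 0 < C := by have := sqrt_pos.2 hD; positivity
  set u : ℕ → ℝ := fun n => n * p ^ (5 * n) * aperyNumber n with hu
  have hulim : Tendsto u atTop (nhds C) := tendsto_mul_pow_mul_aperyNumber hp0 hp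
  set v : ℕ → ℝ := fun n => (n + 1) * p ^ (5 * n) * aperyNumber n with hv
  have hvlim : Tendsto v atTop (nhds C) := by
    have := hulim.div tendsto_natCast_div_add_one one_ne_zero
    rw [div_one] at this
    refine this.congr' ?_
    filter_upwards [eventually_gt_atTop 0] with n hn
    have : (n : ℝ) ≠ 0 := by exact_mod_cast hn.ne'
    simp only [Pi.div_apply, hu, hv]
    field_simp
  have hu1 : Tendsto (fun n => u (n + 1)) atTop (nhds C) := hulim.comp (tendsto_add_atTop_nat 1)
  -- the increments of the sequence of quotients
  set D : ℕ → ℝ := fun n => 5 / (((n : ℝ) + 1) ^ 2 * aperyNumber n * aperyNumber (n + 1)) with hDdef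
  have hDpos : ∀ n, 0 < D n := fun n => by have := hb n; have := hb (n + 1); positivity
  have hDeq : ∀ n, D n = 5 * p ^ 5 * p ^ (10 * n) / (v n * u (n + 1)) := by
    intro n
    have := hb n
    have := hb (n + 1)
    simp only [hDdef, hu, hv]
    push_cast
    field_simp
    ring
  have hDlim : Tendsto (fun n => D n / p ^ (10 * n)) atTop (nhds (5 * p ^ 5 / (C * C))) := by
    refine (tendsto_const_nhds.div (hvlim.mul hu1) (by positivity)).congr fun n => ?_
    rw [Pi.div_apply, hDeq]
    have := hb n
    have := hb (n + 1)
    have : v n * u (n + 1) ≠ 0 := by simp only [hu, hv]; positivity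
    field_simp
  have hDratio : Tendsto (fun n => D (n + 1) / D n) atTop (nhds (p ^ 10)) := by
    have h1 := ((hDlim.comp (tendsto_add_atTop_nat 1)).div hDlim (by positivity)).mul_const (p ^ 10)
    rw [div_self (by positivity), one_mul] at h1
    refine h1.congr fun n => ?_
    have := hDpos n
    simp only [Function.comp_def, Pi.div_apply]
    field_simp
    ring
  set x : ℕ → ℝ := fun n => beukersSum n / aperyNumber n with hx
  have hx0 : ∀ n, 0 ≤ x n := fun n => div_nonneg (beukersSum_nonneg n) (hb n).le
  have hxD : ∀ n, x n + x (n + 1) = D n := by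
    intro n
    have h1 := hb n
    have h2 := hb (n + 1)
    have h3 := beukersSum_casoratian n
    rw [eq_div_iff (by positivity)] at h3
    simp only [hx, hDdef]
    field_simp
    linear_combination h3
  have hw := tendsto_of_backward_recurrence (w := fun n => x n / D n)
    (d := fun n => D (n + 1) / D n) (δ := p ^ 10) (B := 1) ?_ ?_ hDratio ?_
  · have hmul := hw.mul hDlim
    convert! hmul using 2 with n
    · have := hDpos n
      simp only [hx]
      field_simp
    · have hCC : C * C = 1 / (4 * π ^ 2 * (4 * p ^ 6 - p ^ 8)) := by
        rw [hC, div_mul_div_comm, one_mul,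
          show 2 * π * √(4 * p ^ 6 - p ^ 8) * (2 * π * √(4 * p ^ 6 - p ^ 8)) =
            4 * π ^ 2 * (√(4 * p ^ 6 - p ^ 8)) ^ 2 by ring, sq_sqrt hD.le]
      have hkey : 1 + p ^ 10 = 5 * (4 * p ^ 6 - p ^ 8) := by
        have h4 : p ^ 4 = 2 - 3 * p := by linear_combination (p ^ 2 - p + 2) * hp
        have h6 : p ^ 6 = 5 - 8 * p := by linear_combination p ^ 2 * h4 + (5 - 3 * p) * hp
        have h8 : p ^ 8 = 13 - 21 * p := by linear_combination (p ^ 4 + 2 - 3 * p) * h4 + 9 * hp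
        linear_combination p ^ 2 * h8 + (34 - 21 * p) * hp - 20 * h6 + 5 * h8
      rw [hCC, hkey]
      generalize 4 * p ^ 6 - p ^ 8 = y at hD
      field_simp
  · rw [abs_of_pos (by positivity)]
    exact pow_lt_one₀ hp0.le hp1 (by norm_num)
  · intro n
    have h1 := hDpos n
    rw [abs_of_nonneg (div_nonneg (hx0 n) h1.le), div_le_one h1, ← hxD]
    linarith [hx0 (n + 1)]
  · intro n
    have h1 := hDpos n
    have h2 := hDpos (n + 1)
    field_simp
    linarith [hxD n]

/-- Sequences with the same recurrence and the same first two values agree. -/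
lemma eq_of_apery_recurrence {u v : ℕ → ℝ}
    (hu : ∀ n : ℕ, 2 ≤ n →
      u n = (11 * (n : ℝ) ^ 2 - 11 * (n : ℝ) + 3) * u (n - 1) + ((n : ℝ) - 1) ^ 4 * u (n - 2))
    (hv : ∀ n : ℕ, 2 ≤ n →
      v n = (11 * (n : ℝ) ^ 2 - 11 * (n : ℝ) + 3) * v (n - 1) + ((n : ℝ) - 1) ^ 4 * v (n - 2))
    (h0 : u 0 = v 0) (h1 : u 1 = v 1) (n : ℕ) : u n = v n := by
  induction n using Nat.strong_induction_on with
  | _ n ih =>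
    rcases n with _ | _ | n
    · exact h0
    · exact h1
    · rw [hu _ (by omega), hv _ (by omega), ih _ (by omega), ih _ (by omega)]

/-- Small Apéry: the continued fraction `[[0,11n²-11n+3],[5,n⁴]]` converges to
`ζ(2) = π²/6`, with speed `(-1)ⁿ·4π²/((1+√5)/2)^(10n+5)`. -/
theorem small_apery (p q : ℕ → ℝ)
    (hp : ∀ n : ℕ, 2 ≤ n →
      p n = (11 * (n : ℝ) ^ 2 - 11 * (n : ℝ) + 3) * p (n - 1) + ((n : ℝ) - 1) ^ 4 * p (n - 2))
    (hq : ∀ n : ℕ, 2 ≤ n →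
      q n = (11 * (n : ℝ) ^ 2 - 11 * (n : ℝ) + 3) * q (n - 1) + ((n : ℝ) - 1) ^ 4 * q (n - 2))
    (hp0 : p 0 = 0) (hp1 : p 1 = 5) (hq0 : q 0 = 1) (hq1 : q 1 = 3) :
    (∀ n, q n ≠ 0) ∧
    Tendsto (fun n => p n / q n) atTop (nhds (π ^ 2 / 6)) ∧
    (fun n : ℕ => π ^ 2 / 6 - p n / q n) ~[atTop]
      (fun n : ℕ => (-1 : ℝ) ^ n * (4 * π ^ 2) / ((1 + Real.sqrt 5) / 2) ^ (10 * n + 5)) := by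
  have hqn : ∀ n, q n = (n.factorial : ℝ) ^ 2 * aperyNumber n := by
    refine eq_of_apery_recurrence hq (fun n hn => ?_) (by simp [hq0, aperyNumber_zero])
      (by simp [hq1, aperyNumber_one])
    obtain ⟨n, rfl⟩ := Nat.exists_eq_add_of_le' hn
    have := aperyNumber_recurrence n
    rw [show n + 2 - 1 = n + 1 by omega, show n + 2 - 2 = n by omega]
    simp only [Nat.factorial_succ]
    push_cast
    linear_combination ((n : ℝ) + 1) ^ 2 * (n.factorial : ℝ) ^ 2 * this
  have hpn : ∀ n, π ^ 2 / 6 * q n - p n = (-1) ^ n * (n.factorial : ℝ) ^ 2 * beukersSum n := by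
    refine eq_of_apery_recurrence (fun n hn => ?_) (fun n hn => ?_)
      (by simp [hq0, hp0, beukersSum_zero]) (by simp [hq1, hp1, beukersSum_one]; ring)
    · rw [hp n hn, hq n hn]
      ring
    obtain ⟨n, rfl⟩ := Nat.exists_eq_add_of_le' hn
    have := beukersSum_recurrence n
    rw [show n + 2 - 1 = n + 1 by omega, show n + 2 - 2 = n by omega]
    simp only [Nat.factorial_succ]
    push_cast
    linear_combination (-1) ^ n * ((n : ℝ) + 1) ^ 2 * (n.factorial : ℝ) ^ 2 * this
  have hqpos : ∀ n, 0 < q n := fun n => by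
    have := aperyNumber_pos n
    rw [hqn]
    positivity
  have herr : ∀ n, π ^ 2 / 6 - p n / q n = (-1) ^ n * (beukersSum n / aperyNumber n) := by
    intro n
    have h1 := hqpos n
    have h2 := aperyNumber_pos n
    have h3 : π ^ 2 / 6 - p n / q n = (π ^ 2 / 6 * q n - p n) / q n := by field_simp
    rw [h3, hpn, hqn]
    field_simp
  set φ : ℝ := (1 + √5) / 2 with hφ
  have hφ0 : 0 < φ := by positivity
  have hφ2 : φ ^ 2 = φ + 1 := by
    have : √5 ^ 2 = 5 := sq_sqrt (by norm_num)
    rw [hφ]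
    linear_combination this / 4
  have hinv : φ⁻¹ ^ 2 + φ⁻¹ = 1 := by
    field_simp
    linarith
  have hinv1 : φ⁻¹ < 1 := by nlinarith [inv_pos.2 hφ0]
  have hlim := tendsto_beukersSum_div_aperyNumber (inv_pos.2 hφ0) hinv
  refine ⟨fun n => (hqpos n).ne', ?_, ?_⟩
  · have h1 : Tendsto (fun n : ℕ => φ⁻¹ ^ (10 * n)) atTop (nhds 0) := by
      simp_rw [pow_mul]
      exact tendsto_pow_atTop_nhds_zero_of_lt_one (by positivity)
        (pow_lt_one₀ (by positivity) hinv1 (by norm_num))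
    have h2 : Tendsto (fun n => beukersSum n / aperyNumber n) atTop (nhds 0) := by
      have := hlim.mul h1
      rw [mul_zero] at this
      refine this.congr fun n => ?_
      exact div_mul_cancel₀ _ (by positivity)
    have h3 : Tendsto (fun n => π ^ 2 / 6 - p n / q n) atTop (nhds 0) := by
      refine squeeze_zero_norm (fun n => ?_) h2
      rw [herr, norm_mul, norm_pow, norm_neg, norm_one, one_pow, one_mul, Real.norm_of_nonneg]
      exact div_nonneg (beukersSum_nonneg n) (aperyNumber_pos n).le
    have h4 := h3.const_sub (π ^ 2 / 6)
    rw [sub_zero] at h4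
    exact h4.congr fun n => by ring
  · refine isEquivalent_of_tendsto_one ?_
    have h1 := hlim.div_const (4 * π ^ 2 * φ⁻¹ ^ 5)
    rw [div_self (by positivity)] at h1
    refine h1.congr fun n => ?_
    have h2 : ((-1 : ℝ) ^ n) ≠ 0 := pow_ne_zero _ (by norm_num)
    rw [Pi.div_apply, herr, inv_pow, inv_pow, pow_add]
    field_simp
end
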